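/- Let p ∈ [0,1] satisfy θ(p) > 0 and let α > 0. There exists a constant κ > 0 (depending on α and p) such that for every integer n ≥ 2, with probability at least 1 − 1/n^α, the following two facts hold simultaneously: (i) for every x ∈ Λ(n) ∖ Λ(n/4) there exists y ∈ Λ(n/4) with T_{Λ(n)}(x,y) ≤ κ(ln n)², and (ii) T_{Λ(n)}(x,y) ≤ κ(ln n)² for all x, y ∈ Λ(n/4). -/

import Mathlib

open MeasureTheory ENNReal

noncomputable section

/-- A site of the lattice `ℤ³`. -/
abbrev Site := Fin 3 → ℤ

/-- A percolation configuration: `ω z = true` means that the site `z` is open,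
`ω z = false` means that it is closed. -/
abbrev Config := Site → Bool

/-- Two sites are neighbours when their Euclidean distance is `1`. -/
def Adj (x y : Site) : Prop := ∑ i, |x i - y i| = 1

/-- `γ` is a path from `x` to `y` staying inside `A`. -/
def IsPathIn (A : Set Site) (x y : Site) (γ : List Site) : Prop :=
  γ.Chain' Adj ∧ γ.head? = some x ∧ γ.getLast? = some y ∧ ∀ z ∈ γ, z ∈ A

/-- The number of closed sites along the path `γ`. -/
def pathCost (ω : Config) (γ : List Site) : ℕ := γ.countP fun z => !ω z

/-- The travel time `T_A(x,y)` between `x` and `y` inside `A`: the infimum of the number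
of closed sites over all paths from `x` to `y` in `A` (`⊤` if there is no such path). -/
def travelTime (ω : Config) (A : Set Site) (x y : Site) : ℝ≥0∞ :=
  sInf {c : ℝ≥0∞ | ∃ γ : List Site, IsPathIn A x y γ ∧ c = pathCost ω γ}

/-- The travel time `T_A(x,E)` between `x` and the set `E` inside `A`. -/
def travelTimeSet (ω : Config) (A : Set Site) (x : Site) (E : Set Site) : ℝ≥0∞ :=
  ⨅ y ∈ E, travelTime ω A x y

/-- The open cluster `C(x)` of the site `x` (empty when `x` is closed). -/
def cluster (ω : Config) (x : Site) : Set Site :=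
  {y | ∃ γ : List Site, IsPathIn {z | ω z = true} x y γ}

/-- The internal boundary `∂ⁱⁿA` of `A`. -/
def intBd (A : Set Site) : Set Site := {x | x ∈ A ∧ ∃ y ∉ A, Adj x y}

/-- The external boundary `∂ᵒᵘᵗA` of `A`. -/
def extBd (A : Set Site) : Set Site := {x | x ∉ A ∧ ∃ y ∈ A, Adj x y}

/-- `P` is the Bernoulli site percolation measure with parameter `p`: the sites are
independent and each one is open with probability `p`, closed with probability `1 - p`,
as expressed by the probabilities of the cylinder events. -/
def IsBernoulli (p : ℝ) (P : Measure Config) : Prop :=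
  ∀ (s : Finset Site) (f : Site → Bool),
    P {ω | ∀ z ∈ s, ω z = f z} =
      ∏ z ∈ s, (if f z then ENNReal.ofReal p else ENNReal.ofReal (1 - p))

/-- `θ(p)`: the probability that the open cluster of the origin is infinite. -/
def theta (P : Measure Config) : ℝ≥0∞ := P {ω | (cluster ω 0).Infinite}

/-- The box `Λ(r) = [-r, r]³ ∩ ℤ³`. -/
def box (r : ℝ) : Set Site := {z | ∀ i, |(z i : ℝ)| ≤ r}


/-- The cost of a site. -/
def siteCost (ω : Config) (z : Site) : ℕ := if ω z = true then 0 else 1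

lemma siteCost_le_one (ω : Config) (z : Site) : siteCost ω z ≤ 1 := by
  unfold siteCost; split_ifs <;> simp

lemma siteCost_eq (ω : Config) (z : Site) :
    siteCost ω z = List.countP (fun z => !ω z) [z] := by
  cases h : ω z <;> simp [siteCost, h]

/-- `Rch ω A x k z`: there is a path in `A` from `x` to `z` with at most `k` closed sites. -/
inductive Rch (ω : Config) (A : Set Site) (x : Site) : ℕ → Site → Prop
  | start {k : ℕ} : x ∈ A → siteCost ω x ≤ k → Rch ω A x k x
  | step {k l : ℕ} {y z : Site} : Rch ω A x k y → Adj y z → z ∈ A → k + siteCost ω z ≤ l →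
      Rch ω A x l z

lemma Rch.mem {ω : Config} {A : Set Site} {x z : Site} {k : ℕ} (h : Rch ω A x k z) : z ∈ A := by
  cases h <;> assumption

lemma Rch.mono {ω : Config} {A : Set Site} {x z : Site} {k l : ℕ} (h : Rch ω A x k z)
    (hkl : k ≤ l) : Rch ω A x l z := by
  cases h with
  | start h1 h2 => exact .start h1 (h2.trans hkl)
  | step h1 h2 h3 h4 => exact .step h1 h2 h3 (h4.trans hkl)

lemma Rch.mono_set {ω : Config} {A B : Set Site} {x z : Site} {k : ℕ} (h : Rch ω A x k z)
    (hAB : A ⊆ B) : Rch ω B x k z := by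
  induction h with
  | start h1 h2 => exact .start (hAB h1) h2
  | step _ h2 h3 h4 ih => exact .step ih h2 (hAB h3) h4

lemma Rch.trans {ω : Config} {A : Set Site} {x y z : Site} {k l : ℕ} (h : Rch ω A x k y)
    (h' : Rch ω A y l z) : Rch ω A x (k + l) z := by
  induction h' with
  | start h1 h2 => exact h.mono (by omega)
  | step _ h2 h3 h4 ih => exact .step ih h2 h3 (by omega)

lemma Rch.congr {ω ω' : Config} {A : Set Site} {x z : Site} {k : ℕ} (h : Rch ω A x k z)
    (hω : ∀ y ∈ A, ω y = ω' y) : Rch ω' A x k z := by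
  induction h with
  | start h1 h2 => exact .start h1 (by unfold siteCost at *; rwa [← hω _ h1])
  | step _ h2 h3 h4 ih => exact .step ih h2 h3 (by unfold siteCost at *; rwa [← hω _ h3])

lemma Rch.mono_config {ω ω' : Config} {A : Set Site} {x z : Site} {k : ℕ} (h : Rch ω A x k z)
    (hω : ∀ y, ω y = true → ω' y = true) : Rch ω' A x k z := by
  have hc : ∀ y, siteCost ω' y ≤ siteCost ω y := by
    intro y
    unfold siteCost
    have := hω y
    split_ifs <;> simp_all
  induction h with
  | @start k h1 h2 => exact .start h1 ((hc _).trans h2)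
  | @step k l y z _ h2 h3 h4 ih => exact .step ih h2 h3 (by have := hc z; omega)

lemma Rch.equiv {ω : Config} {A : Set Site} {x z : Site} {k : ℕ} (h : Rch ω A x k z)
    (e : Site ≃ Site) (he : ∀ y z, Adj y z ↔ Adj (e y) (e z)) :
    Rch (fun w => ω (e w)) (e ⁻¹' A) (e.symm x) k (e.symm z) := by
  induction h with
  | start h1 h2 => exact .start (by simpa using h1) (by simpa [siteCost] using h2)
  | step _ h2 h3 h4 ih =>
    exact .step ih (by rw [he]; simpa using h2) (by simpa using h3) (by simpa [siteCost] using h4)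

lemma Adj.symm {x y : Site} (h : Adj x y) : Adj y x := by
  unfold Adj at *
  rw [← h]
  exact Finset.sum_congr rfl fun i _ => abs_sub_comm _ _

lemma Rch.toList {ω : Config} {A : Set Site} {x z : Site} {k : ℕ} (h : Rch ω A x k z) :
    ∃ γ, IsPathIn A x z γ ∧ pathCost ω γ ≤ k := by
  induction h with
  | start h1 h2 =>
    refine ⟨[x], ⟨by simp [List.Chain'], by simp, by simp, by simpa using h1⟩, ?_⟩
    rw [siteCost_eq] at h2
    exact h2
  | @step k l y z _ h2 h3 h4 ih =>
    obtain ⟨γ, ⟨a, b, c, d⟩, e⟩ := ih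
    refine ⟨γ ++ [z], ⟨?_, ?_, by simp, ?_⟩, ?_⟩
    · unfold List.Chain' at *
      rw [List.isChain_append]
      refine ⟨a, by simp, ?_⟩
      intro u hu v hv
      rw [c] at hu
      simp at hu hv
      subst hu hv
      exact h2
    · simp [b]
    · intro w hw
      rcases List.mem_append.1 hw with hw | hw
      · exact d w hw
      · simp at hw; rwa [hw]
    · have : siteCost ω z = List.countP (fun z => !ω z) [z] := siteCost_eq ω z
      unfold pathCost at *
      rw [List.countP_append, ← this]
      omega

lemma Rch.ofList {ω : Config} {A : Set Site} {x z : Site} (γ : List Site)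
    (h : IsPathIn A x z γ) : Rch ω A x (pathCost ω γ) z := by
  induction γ using List.reverseRecOn generalizing z with
  | nil => simp [IsPathIn] at h
  | append_singleton γ w ih =>
    obtain ⟨a, b, c, d⟩ := h
    simp at c
    subst c
    have hw : siteCost ω w = List.countP (fun z => !ω z) [w] := siteCost_eq ω w
    unfold List.Chain' at *
    rcases List.eq_nil_or_concat γ with rfl | ⟨γ', y, rfl⟩
    · simp at b d
      subst b
      refine .start d ?_
      rw [hw]; simp [pathCost]
    · rw [List.isChain_append] at a
      refine .step (ih (z := y) ⟨a.1, ?_, by simp, fun z hz => d z (List.mem_append_left _ hz)⟩)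
        (a.2.2 y (by simp) w (by simp)) (d w (by simp)) ?_
      · rw [← b]; simp [List.head?_append]
      · rw [hw]; unfold pathCost; rw [← List.countP_append]

lemma Rch.symm {ω : Config} {A : Set Site} {x z : Site} {k : ℕ} (h : Rch ω A x k z) :
    Rch ω A z k x := by
  obtain ⟨γ, ⟨a, b, c, d⟩, e⟩ := h.toList
  have := Rch.ofList (ω := ω) (A := A) (x := z) (z := x) γ.reverse
    ⟨?_, by simpa using c, by simpa using b, by simpa using d⟩
  · refine this.mono ?_
    simpa [pathCost] using e
  · unfold List.Chain' at *
    rw [List.isChain_reverse]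
    exact a.imp fun _ _ h => h.symm

lemma Rch.travelTime_le {ω : Config} {A : Set Site} {x z : Site} {k : ℕ} (h : Rch ω A x k z) :
    travelTime ω A x z ≤ k := by
  obtain ⟨γ, h1, h2⟩ := h.toList
  unfold travelTime
  have h3 : ((pathCost ω γ : ℕ) : ℝ≥0∞) ≤ k := by exact_mod_cast h2
  exact (sInf_le (by exact ⟨γ, h1, rfl⟩)).trans h3

/-- The exploration neighbourhood. -/
def expl (A : Set Site) (x : Site) (B : Set Site) : Set Site :=
  B ∪ {z | z ∈ A ∧ ∃ y ∈ B, Adj y z} ∪ {x}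

/-- The ball of travel time. -/
def dball (ω : Config) (A : Set Site) (x : Site) (k : ℕ) : Set Site := {z | Rch ω A x k z}

lemma dball_congr {ω ω' : Config} {A : Set Site} {x : Site} {k : ℕ} {B : Set Site}
    (h : dball ω A x k = B) (hω : ∀ y ∈ expl A x B, ω y = ω' y) : dball ω' A x k = B := by
  have hc : ∀ y ∈ expl A x B, siteCost ω y = siteCost ω' y := by
    intro y hy; unfold siteCost; rw [hω y hy]
  have h1 : ∀ l z, Rch ω A x l z → l ≤ k → Rch ω' A x l z := by
    intro l z hz
    induction hz with
    | start h1 h2 => intro _; exact .start h1 (by rwa [← hc _ (by simp [expl])])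
    | @step m l y z h1 h2 h3 h4 ih =>
      intro hl
      refine .step (ih (by omega)) h2 h3 ?_
      rw [← hc]
      · exact h4
      · refine Or.inl (Or.inl ?_)
        rw [← h]
        exact (Rch.step h1 h2 h3 h4).mono hl
  have h2 : ∀ l z, Rch ω' A x l z → l ≤ k → Rch ω A x l z := by
    intro l z hz
    induction hz with
    | start h1 h2 => intro _; exact .start h1 (by rwa [hc _ (by simp [expl])])
    | @step m l y z h1 h2 h3 h4 ih =>
      intro hl
      have hy := ih (by omega)
      refine .step hy h2 h3 ?_
      rw [hc]
      · exact h4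
      · refine Or.inl (Or.inr ⟨h3, y, ?_, h2⟩)
        rw [← h]
        exact hy.mono (by omega)
  rw [← h]
  ext z
  exact ⟨fun hz => h2 _ _ hz le_rfl, fun hz => h1 _ _ hz le_rfl⟩

open Classical in
/-- Open all the sites of `E`. -/
def opened (E : Set Site) (ω : Config) : Config := fun z => if z ∈ E then true else ω z

lemma Rch_of_opened {ω : Config} {A : Set Site} {x z : Site} {k : ℕ}
    (h : Rch (opened (expl A x (dball ω A x k)) ω) A x 0 z) : Rch ω A x (k + 1) z := by
  generalize hl : 0 = l at h
  induction h with
  | start h1 h2 => exact .start h1 ((siteCost_le_one _ _).trans (by omega))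
  | @step m l y z h1 h2 h3 h4 ih =>
    have h0 : m = 0 := by omega
    have hz : siteCost (opened (expl A x (dball ω A x k)) ω) z = 0 := by omega
    have ih' := ih h0.symm
    by_cases hE : z ∈ expl A x (dball ω A x k)
    · rcases hE with (hE | ⟨_, y', hy', ha⟩) | hE
      · exact Rch.mono hE (by omega)
      · exact .step hy' ha h3 (by have := siteCost_le_one ω z; omega)
      · have : z = x := hE
        subst this
        exact .start h3 ((siteCost_le_one _ _).trans (by omega))
    · refine .step ih' h2 h3 ?_
      unfold siteCost opened at hz
      unfold siteCost
      simp [hE] at hz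
      simp [hz]

/-- The one-site law. -/
def nu (p : ℝ) : Measure Bool :=
  ENNReal.ofReal p • Measure.dirac true + ENNReal.ofReal (1 - p) • Measure.dirac false

lemma nu_prob {p : ℝ} (hp : p ∈ Set.Icc (0 : ℝ) 1) : IsProbabilityMeasure (nu p) := by
  constructor
  simp only [nu, Measure.coe_add, Measure.coe_smul, Pi.add_apply, Pi.smul_apply, measure_univ,
    smul_eq_mul, mul_one]
  rw [← ENNReal.ofReal_add hp.1 (by linarith [hp.2])]
  simp

lemma nu_singleton (p : ℝ) (b : Bool) :
    nu p {b} = if b then ENNReal.ofReal p else ENNReal.ofReal (1 - p) := by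
  cases b <;> simp [nu]

lemma restrict_eq {p : ℝ} (hp : p ∈ Set.Icc (0 : ℝ) 1) {P : Measure Config}
    [IsProbabilityMeasure P] (hP : IsBernoulli p P) (s : Finset Site) :
    P.map s.restrict = Measure.pi (fun _ : s => nu p) := by
  have := nu_prob hp
  refine Measure.ext_of_singleton fun g => ?_
  rw [Measure.map_apply (by fun_prop) (measurableSet_singleton g), Measure.pi_singleton]
  have h := hP s (fun z => if hz : z ∈ s then g ⟨z, hz⟩ else true)
  have hset : (fun (ω : Config) (i : s) => ω i) ⁻¹' {g} =
      {ω : Config | ∀ z ∈ s, ω z = (fun z => if hz : z ∈ s then g ⟨z, hz⟩ else true) z} := by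
    ext ω
    simp only [Set.mem_preimage, Set.mem_singleton_iff, Set.mem_ofPred_eq]
    constructor
    · intro h z hz
      rw [← h]
      simp [hz]
    · intro h
      ext ⟨z, hz⟩
      have := h z hz
      simpa [hz] using this
  change P ((fun (ω : Config) (i : s) => ω i) ⁻¹' {g}) = _
  rw [hset, h, ← Finset.prod_coe_sort]
  refine Finset.prod_congr rfl fun i _ => ?_
  simp [nu_singleton]

lemma eq_infinitePi' {p : ℝ} (hp : p ∈ Set.Icc (0 : ℝ) 1) {P : Measure Config}
    [IsProbabilityMeasure P] (hP : IsBernoulli p P) :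
    haveI := nu_prob hp
    P = Measure.infinitePi (fun _ : Site => nu p) := by
  have := nu_prob hp
  refine Measure.eq_infinitePi _ fun s t ht => ?_
  have hset : Set.pi (s : Set Site) t =
      s.restrict ⁻¹' (Set.pi Set.univ (fun i : s => t i)) := by
    ext ω
    simp [Set.mem_pi]
  rw [hset, ← Measure.map_apply (by fun_prop)
    (MeasurableSet.univ_pi fun i => MeasurableSet.of_discrete), restrict_eq hp hP,
    Measure.pi_pi]
  exact Finset.prod_coe_sort s (fun i => nu p (t i))

lemma map_equiv {p : ℝ} (hp : p ∈ Set.Icc (0 : ℝ) 1) {P : Measure Config}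
    [IsProbabilityMeasure P] (hP : IsBernoulli p P) (e : Site ≃ Site) :
    P.map (fun ω z => ω (e z)) = P := by
  have := nu_prob hp
  rw [eq_infinitePi' hp hP]
  exact Measure.map_infinitePi_infinitePi_of_inj (P := fun _ : Site => nu p) e.injective

/-- The event `X` only depends on the sites of `S`. -/
def DependsOnSites (X : Set Config) (S : Set Site) : Prop :=
  ∀ ω ω' : Config, (∀ z ∈ S, ω z = ω' z) → ω ∈ X → ω' ∈ X

lemma DependsOnSites.eq_preimage {X : Set Config} {S : Finset Site}
    (h : DependsOnSites X (S : Set Site)) :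
    X = (fun (ω : Config) (i : S) => ω i) ⁻¹' ((fun (ω : Config) (i : S) => ω i) '' X) := by
  ext ω
  constructor
  · intro hω
    exact ⟨ω, hω, rfl⟩
  · rintro ⟨ω', h1, h2⟩
    exact h ω' ω (fun z hz => congrFun h2 ⟨z, hz⟩) h1

lemma DependsOnSites.measurableSet {X : Set Config} {S : Set Site} (hS : S.Finite)
    (h : DependsOnSites X S) : MeasurableSet X := by
  obtain ⟨S, rfl⟩ := hS.exists_finset_coe
  rw [h.eq_preimage]
  exact (show Measurable (fun (ω : Config) (i : S) => ω i) by fun_prop) MeasurableSet.of_discrete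

lemma indep_sites {p : ℝ} (hp : p ∈ Set.Icc (0 : ℝ) 1) {P : Measure Config}
    [IsProbabilityMeasure P] (hP : IsBernoulli p P) {X Y : Set Config} {S T : Set Site}
    (hS : S.Finite) (hT : T.Finite) (hST : Disjoint S T)
    (hX : DependsOnSites X S) (hY : DependsOnSites Y T) : P (X ∩ Y) = P X * P Y := by
  obtain ⟨S, rfl⟩ := hS.exists_finset_coe
  obtain ⟨T, rfl⟩ := hT.exists_finset_coe
  have := nu_prob hp
  have hI : ProbabilityTheory.iIndepFun (fun (i : Site) (ω : Config) => ω i) P := by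
    rw [eq_infinitePi' hp hP]
    exact ProbabilityTheory.iIndepFun_infinitePi (P := fun _ : Site => nu p)
      (X := fun _ b => b) (fun _ => measurable_id)
  have h2 := hI.indepFun_finset S T (by simpa using hST) (by fun_prop)
  rw [hX.eq_preimage, hY.eq_preimage]
  exact h2.measure_inter_preimage_eq_mul _ _ MeasurableSet.of_discrete MeasurableSet.of_discrete

/-- The event that no point of `F` is reached at cost `k`. -/
def noHit (A : Set Site) (x : Site) (F : Set Site) (k : ℕ) : Set Config :=
  {ω | ∀ y ∈ F, ¬ Rch ω A x k y}

lemma noHit_depends (A : Set Site) (x : Site) (F : Set Site) (k : ℕ) :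
    DependsOnSites (noHit A x F k) A := by
  intro ω ω' h hω y hy hr
  exact hω y hy (hr.congr fun z hz => (h z hz).symm)

lemma noHit_succ {p : ℝ} (hp : p ∈ Set.Icc (0 : ℝ) 1) {P : Measure Config}
    [IsProbabilityMeasure P] (hP : IsBernoulli p P) {A : Set Site} (hA : A.Finite) {x : Site}
    (hx : x ∈ A) (F : Set Site) (k : ℕ) :
    P (noHit A x F (k + 1)) ≤ P (noHit A x F k) * P (noHit A x F 0) := by
  classical
  obtain ⟨A, rfl⟩ := hA.exists_finset_coe
  set A' : Set Site := (A : Set Site) with hA'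
  let D : Finset Site → Set Config := fun B => {ω | dball ω A' x k = (B : Set Site)}
  let G : Finset Site → Set Config := fun B =>
    {ω | ∀ y ∈ F, ¬ Rch (opened (expl A' x B) ω) A' x 0 y}
  let I : Finset (Finset Site) := A.powerset.filter fun B => Disjoint (B : Set Site) F
  have hsub : noHit A' x F (k + 1) ⊆ ⋃ B ∈ I, (D B ∩ G B) := by
    intro ω hω
    have hfin : (dball ω A' x k).Finite := A.finite_toSet.subset fun z hz => Rch.mem hz
    have hB : (hfin.toFinset : Set Site) = dball ω A' x k := hfin.coe_toFinset
    simp only [Set.mem_iUnion]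
    refine ⟨hfin.toFinset, ?_, hB.symm, ?_⟩
    · simp only [I, Finset.mem_filter, Finset.mem_powerset, hB]
      refine ⟨?_, ?_⟩
      · rw [← Finset.coe_subset, hB]
        exact fun z hz => Rch.mem hz
      · rw [Set.disjoint_left]
        intro y hy hF
        exact hω y hF (Rch.mono hy (by omega))
    · intro y hy hr
      rw [hB] at hr
      exact hω y hy (Rch_of_opened hr)
  have hexpl : ∀ B ∈ I, expl A' x B ⊆ A' := by
    intro B hB z hz
    have hBA : B ⊆ A := by
      simp only [I, Finset.mem_filter, Finset.mem_powerset] at hB; exact hB.1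
    rcases hz with (hz | hz) | hz
    · exact hBA hz
    · exact hz.1
    · have : z = x := hz
      rwa [this]
  have hDdep : ∀ B, DependsOnSites (D B) (expl A' x B) := fun B ω ω' h hω => dball_congr hω h
  have hGdep : ∀ B, DependsOnSites (G B) (A' \ expl A' x B) := by
    intro B ω ω' h hω y hy hr
    refine hω y hy (hr.congr fun z hz => ?_)
    unfold opened
    split_ifs with hE
    · rfl
    · exact (h z ⟨hz, hE⟩).symm
  have hGsub : ∀ B, G B ⊆ noHit A' x F 0 := by
    intro B ω hω y hy hr
    refine hω y hy (hr.mono_config fun z hz => ?_)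
    unfold opened
    split_ifs <;> simp [hz]
  have hDmeas : ∀ B ∈ I, MeasurableSet (D B) := fun B hB =>
    (hDdep B).measurableSet (A.finite_toSet.subset (hexpl B hB))
  calc P (noHit A' x F (k + 1)) ≤ P (⋃ B ∈ I, (D B ∩ G B)) := measure_mono hsub
    _ ≤ ∑ B ∈ I, P (D B ∩ G B) := measure_biUnion_finset_le _ _
    _ = ∑ B ∈ I, P (D B) * P (G B) := by
        refine Finset.sum_congr rfl fun B hB => ?_
        exact indep_sites hp hP (A.finite_toSet.subset (hexpl B hB))
          (A.finite_toSet.subset Set.sdiff_subset) Set.disjoint_sdiff_right (hDdep B) (hGdep B)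
    _ ≤ ∑ B ∈ I, P (D B) * P (noHit A' x F 0) := by
        gcongr
        exact hGsub _
    _ = (∑ B ∈ I, P (D B)) * P (noHit A' x F 0) := by rw [Finset.sum_mul]
    _ = P (⋃ B ∈ I, D B) * P (noHit A' x F 0) := by
        rw [measure_biUnion_finset _ hDmeas]
        intro B _ C _ hBC
        rw [Function.onFun, Set.disjoint_left]
        intro ω h1 h2
        apply hBC
        have : (B : Set Site) = C := h1.symm.trans h2
        exact_mod_cast this
    _ ≤ P (noHit A' x F k) * P (noHit A' x F 0) := by
        gcongr
        intro ω hω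
        simp only [Set.mem_iUnion] at hω
        obtain ⟨B, hB, hD⟩ := hω
        simp only [I, Finset.mem_filter] at hB
        intro y hy hr
        refine Set.disjoint_left.1 hB.2 ?_ hy
        rw [← (show dball ω A' x k = B from hD)]
        exact hr

lemma noHit_pow {p : ℝ} (hp : p ∈ Set.Icc (0 : ℝ) 1) {P : Measure Config}
    [IsProbabilityMeasure P] (hP : IsBernoulli p P) {A : Set Site} (hA : A.Finite) {x : Site}
    (hx : x ∈ A) (F : Set Site) (k : ℕ) :
    P (noHit A x F k) ≤ P (noHit A x F 0) ^ (k + 1) := by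
  induction k with
  | zero => simp
  | succ k ih =>
    refine (noHit_succ hp hP hA hx F k).trans ?_
    rw [pow_succ (P (noHit A x F 0)) (k + 1)]
    gcongr

/-- The cube of centre `x` and radius `m`. -/
def cube (x : Site) (m : ℕ) : Set Site := {z | ∀ i, |z i - x i| ≤ m}

lemma cube_finite (x : Site) (m : ℕ) : (cube x m).Finite := by
  refine (Set.finite_Icc (fun i => x i - m : Site) (fun i => x i + m)).subset ?_
  intro z hz
  constructor <;> intro i <;> have := abs_le.1 (hz i) <;> simp only <;> linarith

lemma self_mem_cube (x : Site) (m : ℕ) : x ∈ cube x m := by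
  intro i; simp

/-- A piece of the boundary of the cube. -/
def piece (x : Site) (m : ℕ) (i : Fin 3) (s : Fin 3 → ℤˣ) : Set Site :=
  {y | y i = x i + s i * m ∧ ∀ j, 0 ≤ (s j : ℤ) * (y j - x j)}

/-- The symmetry of the lattice sending the reference piece to the given piece. -/
def symEquiv (x : Site) (i : Fin 3) (s : Fin 3 → ℤˣ) : Site ≃ Site where
  toFun w := fun j => x j + s j * w (Equiv.swap 0 i j)
  invFun y := fun j => s (Equiv.swap 0 i j) * (y (Equiv.swap 0 i j) - x (Equiv.swap 0 i j))
  left_inv w := by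
    ext j
    simp only [Equiv.swap_apply_self, add_sub_cancel_left]
    rw [← mul_assoc, ← Units.val_mul, Int.units_mul_self]
    simp
  right_inv y := by
    ext j
    simp only [Equiv.swap_apply_self]
    rw [← mul_assoc, ← Units.val_mul, Int.units_mul_self]
    simp

lemma abs_units_mul (u : ℤˣ) (a : ℤ) : |(u : ℤ) * a| = |a| := by
  rcases Int.units_eq_one_or u with h | h <;> simp [h]

lemma symEquiv_adj (x : Site) (i : Fin 3) (s : Fin 3 → ℤˣ) (y z : Site) :
    Adj y z ↔ Adj (symEquiv x i s y) (symEquiv x i s z) := by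
  unfold Adj
  have : ∑ j, |symEquiv x i s y j - symEquiv x i s z j| =
      ∑ j, |y (Equiv.swap 0 i j) - z (Equiv.swap 0 i j)| := by
    refine Finset.sum_congr rfl fun j _ => ?_
    simp only [symEquiv, Equiv.coe_fn_mk, add_sub_add_left_eq_sub, ← mul_sub, abs_units_mul]
  rw [this, Equiv.sum_comp (Equiv.swap 0 i) (fun j => |y j - z j|)]

lemma symEquiv_cube (x : Site) (m : ℕ) (i : Fin 3) (s : Fin 3 → ℤˣ) (w : Site) :
    symEquiv x i s w ∈ cube x m ↔ w ∈ cube 0 m := by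
  simp only [cube, symEquiv, Equiv.coe_fn_mk, Set.mem_ofPred_eq, add_sub_cancel_left,
    abs_units_mul, Pi.zero_apply, sub_zero]
  constructor
  · intro h j
    have := h (Equiv.swap 0 i j)
    rwa [Equiv.swap_apply_self] at this
  · intro h j
    exact h _

lemma symEquiv_piece (x : Site) (m : ℕ) (i : Fin 3) (s : Fin 3 → ℤˣ) (w : Site) :
    symEquiv x i s w ∈ piece x m i s ↔ w ∈ piece 0 m 0 1 := by
  have hu : ∀ j (a : ℤ), (s j : ℤ) * ((s j : ℤ) * a) = a := by
    intro j a
    rw [← mul_assoc, ← Units.val_mul, Int.units_mul_self]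
    simp
  simp only [piece, symEquiv, Equiv.coe_fn_mk, Set.mem_ofPred_eq, add_sub_cancel_left,
    Pi.zero_apply, sub_zero, hu, Equiv.swap_apply_right, Pi.one_apply,
    Units.val_one, one_mul, zero_add]
  refine and_congr ?_ ?_
  · constructor
    · intro h
      have := congrArg (fun a => (s i : ℤ) * a) h
      simpa [hu] using this
    · intro h; rw [h]
  · constructor
    · intro h j
      have := h (Equiv.swap 0 i j)
      rwa [Equiv.swap_apply_self] at this
    · intro h j
      exact h _

lemma symEquiv_zero (x : Site) (i : Fin 3) (s : Fin 3 → ℤˣ) : symEquiv x i s 0 = x := by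
  ext j; simp [symEquiv]

lemma noHit_sym (x : Site) (m : ℕ) (i : Fin 3) (s : Fin 3 → ℤˣ) :
    noHit (cube x m) x (piece x m i s) 0 =
      (fun (ω : Config) z => ω (symEquiv x i s z)) ⁻¹' noHit (cube 0 m) 0 (piece 0 m 0 1) 0 := by
  set e := symEquiv x i s with he
  have he0 : e.symm x = 0 := by rw [Equiv.symm_apply_eq]; exact (symEquiv_zero x i s).symm
  have hpre : e ⁻¹' cube x m = cube 0 m := by
    ext w; exact symEquiv_cube x m i s w
  ext ω
  constructor
  · intro h w hw hr
    have hr' := hr.equiv e.symm (fun y z => by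
      have := symEquiv_adj x i s (e.symm y) (e.symm z)
      simp only [← he, Equiv.apply_symm_apply] at this
      exact this.symm)
    simp only [Equiv.symm_symm, Equiv.apply_symm_apply] at hr'
    rw [he, symEquiv_zero, ← he, ← hpre] at hr'
    refine h (e w) ((symEquiv_piece x m i s w).2 hw) ?_
    simpa [Set.preimage_preimage] using hr'
  · intro h y hy hr
    have hr' := hr.equiv e (symEquiv_adj x i s)
    rw [he0, hpre] at hr'
    refine h _ ?_ hr'
    rw [← symEquiv_piece x m i s, ← he]
    simpa using hy

lemma prob_noHit_sym {p : ℝ} (hp : p ∈ Set.Icc (0 : ℝ) 1) {P : Measure Config}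
    [IsProbabilityMeasure P] (hP : IsBernoulli p P) (x : Site) (m : ℕ) (i : Fin 3)
    (s : Fin 3 → ℤˣ) :
    P (noHit (cube x m) x (piece x m i s) 0) = P (noHit (cube 0 m) 0 (piece 0 m 0 1) 0) := by
  rw [noHit_sym, ← Measure.map_apply (by fun_prop)
    ((noHit_depends _ _ _ _).measurableSet (cube_finite _ _)), map_equiv hp hP]

lemma adj_abs_le {x y : Site} (h : Adj x y) (i : Fin 3) : |x i - y i| ≤ 1 := by
  unfold Adj at h
  rw [← h]
  exact Finset.single_le_sum (f := fun i => |x i - y i|) (fun i _ => abs_nonneg _)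
    (Finset.mem_univ i)

lemma exit_cube {ω : Config} {m : ℕ} {k : ℕ} {y : Site} (h : Rch ω Set.univ 0 k y) :
    (∃ w, Rch ω (cube 0 m) 0 k w ∧ ∃ i, |w i| = m) ∨
      (Rch ω (cube 0 m) 0 k y ∧ ∀ i, |y i| < m) := by
  have key : ∀ k z, Rch ω (cube 0 m) 0 k z → (∃ w, Rch ω (cube 0 m) 0 k w ∧ ∃ i, |w i| = m) ∨
      (Rch ω (cube 0 m) 0 k z ∧ ∀ i, |z i| < m) := by
    intro k z hz
    by_cases hi : ∃ i, |z i| = m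
    · exact Or.inl ⟨z, hz, hi⟩
    · push Not at hi
      refine Or.inr ⟨hz, fun i => lt_of_le_of_ne ?_ (hi i)⟩
      simpa using hz.mem i
  induction h with
  | start h1 h2 => exact key _ _ (.start (self_mem_cube _ _) h2)
  | @step k l y z h1 h2 h3 h4 ih =>
    rcases ih with ⟨w, hw, hi⟩ | ⟨hy, hlt⟩
    · exact Or.inl ⟨w, hw.mono (by omega), hi⟩
    · refine key _ _ (.step hy h2 ?_ h4)
      intro i
      have h5 := adj_abs_le h2 i
      have h6 := hlt i
      simp only [Pi.zero_apply, sub_zero]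
      rw [abs_le] at *
      rw [abs_lt] at h6
      constructor <;> omega

/-- The sign of a coordinate. -/
def sgn (a : ℤ) : ℤˣ := if 0 ≤ a then 1 else -1

lemma sgn_mul (a : ℤ) : (sgn a : ℤ) * a = |a| := by
  unfold sgn
  split_ifs with h
  · simp [abs_of_nonneg h]
  · simp [abs_of_neg (not_le.1 h)]

lemma theta_le {p : ℝ} (hp : p ∈ Set.Icc (0 : ℝ) 1) {P : Measure Config}
    [IsProbabilityMeasure P] (hP : IsBernoulli p P) (m : ℕ) :
    theta P ≤ 24 * P (noHit (cube 0 m) 0 (piece 0 m 0 1) 0)ᶜ := by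
  have hsub : {ω | (cluster ω 0).Infinite} ⊆
      ⋃ a : Fin 3 × (Fin 3 → ℤˣ), (noHit (cube 0 m) 0 (piece 0 m a.1 a.2) 0)ᶜ := by
    intro ω hω
    obtain ⟨y, hy, hy2⟩ := Set.Infinite.exists_notMem_finite hω (cube_finite 0 m)
    obtain ⟨γ, hγ⟩ := hy
    have hγ' : IsPathIn Set.univ 0 y γ := ⟨hγ.1, hγ.2.1, hγ.2.2.1, by simp⟩
    have hcost : pathCost ω γ = 0 := by
      unfold pathCost
      rw [List.countP_eq_zero]
      intro z hz
      have : ω z = true := hγ.2.2.2 z hz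
      simp [this]
    have hr := Rch.ofList (ω := ω) γ hγ'
    rw [hcost] at hr
    rcases exit_cube (m := m) hr with ⟨w, hw, i, hi⟩ | ⟨h1, _⟩
    · simp only [Set.mem_iUnion]
      refine ⟨(i, fun j => sgn (w j)), ?_⟩
      intro hno
      refine hno w ⟨?_, ?_⟩ hw
      · simp only [Pi.zero_apply, zero_add]
        rw [← hi, ← sgn_mul, ← mul_assoc, ← Units.val_mul, Int.units_mul_self]
        simp
      · intro j
        simp [sgn_mul]
    · exact absurd h1.mem hy2
  have hm : ∀ a : Fin 3 × (Fin 3 → ℤˣ), P (noHit (cube 0 m) 0 (piece 0 m a.1 a.2) 0)ᶜ =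
      P (noHit (cube 0 m) 0 (piece 0 m 0 1) 0)ᶜ := by
    intro a
    rw [measure_compl ((noHit_depends _ _ _ _).measurableSet (cube_finite _ _)) (measure_ne_top _ _),
      measure_compl ((noHit_depends _ _ _ _).measurableSet (cube_finite _ _)) (measure_ne_top _ _),
      prob_noHit_sym hp hP]
  calc theta P ≤ P (⋃ a : Fin 3 × (Fin 3 → ℤˣ),
        (noHit (cube 0 m) 0 (piece 0 m a.1 a.2) 0)ᶜ) := measure_mono hsub
    _ ≤ ∑ a : Fin 3 × (Fin 3 → ℤˣ), P (noHit (cube 0 m) 0 (piece 0 m a.1 a.2) 0)ᶜ :=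
        measure_iUnion_fintype_le _ _
    _ = 24 * P (noHit (cube 0 m) 0 (piece 0 m 0 1) 0)ᶜ := by
        simp only [hm]
        simp [Fintype.card_units_int]

lemma prob_noHit_zero {p : ℝ} (hp : p ∈ Set.Icc (0 : ℝ) 1) {P : Measure Config}
    [IsProbabilityMeasure P] (hP : IsBernoulli p P) (x : Site) (m : ℕ) (i : Fin 3)
    (s : Fin 3 → ℤˣ) :
    P (noHit (cube x m) x (piece x m i s) 0) ≤ ENNReal.ofReal (1 - (theta P).toReal / 24) := by
  rw [prob_noHit_sym hp hP]
  have h := theta_le hp hP m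
  set N := noHit (cube 0 m) 0 (piece 0 m 0 1) 0
  have hN : MeasurableSet N := (noHit_depends _ _ _ _).measurableSet (cube_finite _ _)
  rw [ENNReal.le_ofReal_iff_toReal_le (measure_ne_top _ _)]
  · have h2 : (theta P).toReal ≤ 24 * (P Nᶜ).toReal := by
      have := ENNReal.toReal_mono (by finiteness) h
      simpa using this
    have h3 : (P Nᶜ).toReal = 1 - (P N).toReal := by
      have := probReal_compl_eq_one_sub (μ := P) hN
      simpa [Measure.real] using this
    linarith
  · have : (theta P).toReal ≤ 1 := by
      have h4 : theta P ≤ 1 := prob_le_one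
      simpa using ENNReal.toReal_mono (by simp) h4
    linarith

lemma prob_noHit_pow {p : ℝ} (hp : p ∈ Set.Icc (0 : ℝ) 1) {P : Measure Config}
    [IsProbabilityMeasure P] (hP : IsBernoulli p P) (x : Site) (m : ℕ) (i : Fin 3)
    (s : Fin 3 → ℤˣ) (k : ℕ) :
    P (noHit (cube x m) x (piece x m i s) k) ≤
      ENNReal.ofReal (1 - (theta P).toReal / 24) ^ (k + 1) := by
  refine (noHit_pow hp hP (cube_finite _ _) (self_mem_cube _ _) _ k).trans ?_
  gcongr
  exact prob_noHit_zero hp hP x m i s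

/-- The good event: every point can move to every piece of every cube at cost at most `K`. -/
def GoodCfg (n K : ℕ) (ω : Config) : Prop :=
  ∀ x ∈ cube 0 n, ∀ m ≤ n, ∀ i s, ∃ y ∈ piece x m i s, Rch ω (cube x m) x K y

/-- One can decrease the given coordinate by `m`. -/
def CanMove (n K R m : ℕ) (ω : Config) : Prop :=
  ∀ (i : Fin 3) (x : Site), (∀ j, |x j| ≤ R) →
    ∃ y, Rch ω (cube 0 n) x K y ∧ (∀ j, |y j| ≤ R) ∧ |y i| ≤ R - m ∧
      ∀ j, |x j| ≤ R - m → |y j| ≤ R - m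

lemma rch_self {ω : Config} {n R : ℕ} (hR : R ≤ n) {x : Site} (hx : ∀ j, |x j| ≤ R) :
    Rch ω (cube 0 n) x 1 x := by
  refine .start ?_ (siteCost_le_one _ _)
  intro j
  have := hx j
  simp only [Pi.zero_apply, sub_zero]
  omega

lemma CanMove.all {n K R m : ℕ} {ω : Config} (h : CanMove n K R m ω) {x : Site}
    (hx : ∀ j, |x j| ≤ R) : ∃ y, Rch ω (cube 0 n) x (3 * K) y ∧ ∀ j, |y j| ≤ (R : ℤ) - m := by
  obtain ⟨a, a1, a2, a3, a4⟩ := h 0 x hx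
  obtain ⟨b, b1, b2, b3, b4⟩ := h 1 a a2
  obtain ⟨c, c1, c2, c3, c4⟩ := h 2 b b2
  refine ⟨c, ((a1.trans b1).trans c1).mono (by omega), ?_⟩
  intro j
  fin_cases j
  · exact c4 _ (b4 _ a3)
  · exact c4 _ b3
  · exact c3

lemma canMove_one {n R : ℕ} (ω : Config) (hR : 1 ≤ R) (hRn : R ≤ n) : CanMove n 2 R 1 ω := by
  intro i x hx
  by_cases hi : |x i| ≤ (R : ℤ) - 1
  · exact ⟨x, (rch_self hRn hx).mono (by omega), hx, by simpa using hi, fun j h => h⟩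
  · have hi' : |x i| = R := le_antisymm (hx i) (by omega)
    let y : Site := Function.update x i (x i - sgn (x i))
    have hy : |y i| = (R : ℤ) - 1 := by
      simp only [y, Function.update_self]
      unfold sgn
      split_ifs with h
      · rw [abs_of_nonneg h] at hi'
        rw [Units.val_one, abs_of_nonneg] <;> omega
      · rw [abs_of_neg (by omega)] at hi'
        simp only [Units.val_neg, Units.val_one]
        rw [abs_of_nonpos] <;> omega
    have hy2 : ∀ j, j ≠ i → y j = x j := fun j hj => by simp [y, hj]
    have hyR : ∀ j, |y j| ≤ R := by
      intro j
      by_cases hj : j = i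
      · rw [hj, hy]; omega
      · rw [hy2 j hj]; exact hx j
    refine ⟨y, .step (rch_self hRn hx) ?_ ?_ (by have := siteCost_le_one ω y; omega), hyR,
      by simp [hy], ?_⟩
    · unfold Adj
      rw [Finset.sum_eq_single i]
      · have : |(sgn (x i) : ℤ)| = 1 := by
          unfold sgn; split_ifs <;> simp
        simpa [y] using this
      · intro j _ hj
        simp [hy2 j hj]
      · simp
    · intro j
      have := hyR j
      simp only [Pi.zero_apply, sub_zero]
      omega
    · intro j hj
      by_cases hji : j = i
      · rw [hji]; simp [hy]
      · rw [hy2 j hji]; exact hj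

lemma canMove_good {n K R m : ℕ} {ω : Config} (hω : GoodCfg n K ω) (hK : 1 ≤ K)
    (h1 : R + m ≤ n) (h2 : 2 * m ≤ R) : CanMove n K R m ω := by
  intro i x hx
  by_cases hi : |x i| ≤ (R : ℤ) - m
  · exact ⟨x, (rch_self (by omega) hx).mono hK, hx, hi, fun j h => h⟩
  have hxn : x ∈ cube 0 n := by
    intro j
    have := hx j
    simp only [Pi.zero_apply, sub_zero]
    omega
  obtain ⟨y, ⟨hy1, hy2⟩, hr⟩ := hω x hxn m (by omega) i (fun j => - sgn (x j))
  have hmem := hr.mem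
  have hsub : cube x m ⊆ cube 0 n := by
    intro z hz j
    have a := hx j
    have b := hz j
    simp only [Pi.zero_apply, sub_zero]
    rw [abs_le] at *
    constructor <;> omega
  have hmax : ∀ j, |y j| ≤ |x j| ∨ |y j| ≤ m := by
    intro j
    have a := hy2 j
    have b := abs_le.1 (hmem j)
    beta_reduce at a
    unfold sgn at a
    split_ifs at a with h
    · simp at a
      rw [abs_of_nonneg h]
      by_cases hy0 : 0 ≤ y j
      · left; rw [abs_of_nonneg hy0]; omega
      · right; rw [abs_of_neg (by omega)]; omega
    · simp at a
      rw [abs_of_neg (not_le.1 h)]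
      by_cases hy0 : 0 ≤ y j
      · right; rw [abs_of_nonneg hy0]; omega
      · left; rw [abs_of_neg (by omega)]; omega
  refine ⟨y, hr.mono_set hsub, ?_, ?_, ?_⟩
  · intro j
    have := hx j
    rcases hmax j with h | h <;> omega
  · have a := hx i
    beta_reduce at hy1
    unfold sgn at hy1
    split_ifs at hy1 with h
    · simp at hy1
      rw [abs_of_nonneg h] at a hi
      rw [hy1, abs_le]
      constructor <;> omega
    · simp at hy1
      rw [abs_of_neg (not_le.1 h)] at a hi
      rw [hy1, abs_le]
      constructor <;> omega
  · intro j hj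
    rcases hmax j with h | h <;> omega

lemma phase_two {n K : ℕ} {ω : Config} (hω : GoodCfg n K ω) (hK : 1 ≤ K) (t : ℕ) :
    ∀ (R : ℕ), R ≤ 2 ^ t → 3 * R ≤ 2 * n → R ≤ n → ∀ x : Site, (∀ j, |x j| ≤ R) →
      Rch ω (cube 0 n) x (3 * K * t + 6) 0 := by
  induction t with
  | zero =>
    intro R h1 h2 h3 x hx
    have hz : ∀ y : Site, (∀ j, |y j| ≤ (0 : ℤ)) → y = 0 := by
      intro y hy
      ext j
      exact abs_nonpos_iff.1 (hy j)
    rcases Nat.eq_zero_or_pos R with rfl | hR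
    · have hx0 := hz x (by simpa using hx)
      have := rch_self (ω := ω) h3 hx
      rw [hx0] at this ⊢
      exact this.mono (by omega)
    · obtain ⟨y, hy, hy2⟩ := (canMove_one ω hR h3).all hx
      have hR1 : R = 1 := by simp at h1; omega
      have hy0 := hz y (by intro j; have := hy2 j; rw [hR1] at this; simpa using this)
      rw [hy0] at hy
      exact hy.mono (by omega)
  | succ t ih =>
    intro R h1 h2 h3 x hx
    rw [pow_succ] at h1
    obtain ⟨y, hy, hy2⟩ := (canMove_good (m := R / 2) hω hK (by omega) (by omega)).all hx
    have := ih (R - R / 2) (by omega) (by omega) (by omega) y (fun j => by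
      have := hy2 j; omega)
    refine (hy.trans this).mono ?_
    ring_nf
    omega

lemma phase_one {n K T : ℕ} {ω : Config} (hω : GoodCfg n K ω) (hK : 1 ≤ K) (hT : n ≤ 2 ^ T)
    (t : ℕ) : ∀ (R : ℕ), R ≤ n → n ≤ (n - R) * 2 ^ t → ∀ x : Site, (∀ j, |x j| ≤ R) →
      Rch ω (cube 0 n) x (3 * K * t + (3 * K * T + 6)) 0 := by
  induction t with
  | zero =>
    intro R h1 h2 x hx
    refine (phase_two hω hK T R (by omega) ?_ h1 x hx).mono (by omega)
    simp at h2
    omega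
  | succ t ih =>
    intro R h1 h2 x hx
    by_cases h3 : 3 * R ≤ 2 * n
    · exact (phase_two hω hK T R (by omega) h3 h1 x hx).mono (by omega)
    · obtain ⟨y, hy, hy2⟩ := (canMove_good (m := n - R) hω hK (by omega) (by omega)).all hx
      have := ih (R - (n - R)) (by omega) ?_ y (fun j => by have := hy2 j; omega)
      · refine (hy.trans this).mono ?_
        ring_nf
        omega
      · have h4 : n - (R - (n - R)) = (n - R) * 2 := by omega
        rw [h4, mul_assoc, ← pow_succ']
        exact h2

lemma reach_zero {n K T : ℕ} {ω : Config} (hn : 1 ≤ n) (hω : GoodCfg n K ω) (hK : 1 ≤ K)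
    (hT : n ≤ 2 ^ T) {x : Site} (hx : ∀ j, |x j| ≤ n) :
    Rch ω (cube 0 n) x (6 * K * T + 12) 0 := by
  obtain ⟨y, hy, hy2⟩ := (canMove_one ω hn le_rfl).all hx
  have := phase_one hω hK hT T (n - 1) (by omega) (by
    have : n - (n - 1) = 1 := by omega
    rw [this]; simpa using hT) y (fun j => by have := hy2 j; omega)
  refine (hy.trans this).mono ?_
  ring_nf
  omega

lemma cube_eq_box (n : ℕ) : cube 0 n = box n := by
  ext z
  simp only [cube, box, Set.mem_ofPred_eq, Pi.zero_apply, sub_zero]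
  refine forall_congr' fun i => ?_
  rw [← Int.cast_abs]
  exact_mod_cast Iff.rfl

lemma prob_bad {p : ℝ} (hp : p ∈ Set.Icc (0 : ℝ) 1) {P : Measure Config}
    [IsProbabilityMeasure P] (hP : IsBernoulli p P) (n K : ℕ) :
    P {ω | ¬ GoodCfg n K ω} ≤ (((2 * n + 1) ^ 3 * ((n + 1) * 24) : ℕ) : ℝ≥0∞) *
      ENNReal.ofReal (1 - (theta P).toReal / 24) ^ (K + 1) := by
  let I : Finset Site := Finset.Icc (fun _ => -(n : ℤ)) (fun _ => (n : ℤ))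
  have hI : I.card = (2 * n + 1) ^ 3 := by
    simp only [I, Pi.card_Icc, Int.card_Icc, Finset.prod_const, Finset.card_univ,
      Fintype.card_fin]
    congr 1
    omega
  let J : Finset (Site × ℕ × Fin 3 × (Fin 3 → ℤˣ)) :=
    I ×ˢ (Finset.range (n + 1) ×ˢ (Finset.univ ×ˢ Finset.univ))
  have hJ : J.card = (2 * n + 1) ^ 3 * ((n + 1) * 24) := by
    simp [J, Finset.card_product, hI, Fintype.card_units_int]
  have hsub : {ω | ¬ GoodCfg n K ω} ⊆ ⋃ a ∈ J,
      noHit (cube a.1 a.2.1) a.1 (piece a.1 a.2.1 a.2.2.1 a.2.2.2) K := by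
    intro ω hω
    have hω' : ¬ GoodCfg n K ω := hω
    unfold GoodCfg at hω'
    push Not at hω'
    obtain ⟨x, hx, m, hm, i, s, h⟩ := hω'
    simp only [Set.mem_iUnion]
    refine ⟨(x, m, i, s), ?_, h⟩
    simp only [J, I, Finset.mem_product, Finset.mem_Icc, Finset.mem_range, Finset.mem_univ,
      and_true]
    refine ⟨⟨fun j => ?_, fun j => ?_⟩, by omega⟩
    · have := abs_le.1 (hx j); simp at this; exact this.1
    · have := abs_le.1 (hx j); simp at this; exact this.2
  calc P {ω | ¬ GoodCfg n K ω} ≤ P (⋃ a ∈ J,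
        noHit (cube a.1 a.2.1) a.1 (piece a.1 a.2.1 a.2.2.1 a.2.2.2) K) := measure_mono hsub
    _ ≤ ∑ a ∈ J, P (noHit (cube a.1 a.2.1) a.1 (piece a.1 a.2.1 a.2.2.1 a.2.2.2) K) :=
        measure_biUnion_finset_le _ _
    _ ≤ ∑ a ∈ J, ENNReal.ofReal (1 - (theta P).toReal / 24) ^ (K + 1) :=
        Finset.sum_le_sum fun a _ => prob_noHit_pow hp hP _ _ _ _ _
    _ = _ := by rw [Finset.sum_const, hJ, nsmul_eq_mul]

lemma real_bound {δ α : ℝ} (hδ : 0 < δ) (hδ1 : δ ≤ 1) (n K : ℕ) (hn : 2 ≤ n)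
    (hK : (α + 15) / δ * Real.log n ≤ K) :
    (((2 * n + 1) ^ 3 * ((n + 1) * 24) : ℕ) : ℝ) * (1 - δ) ^ (K + 1) ≤ (n : ℝ) ^ (-α) := by
  have hn0 : (0 : ℝ) < n := by positivity
  have h1 : (1 - δ) ^ (K + 1) ≤ (n : ℝ) ^ (-(α + 15)) := by
    calc (1 - δ) ^ (K + 1) ≤ (1 - δ) ^ K := by
          apply pow_le_pow_of_le_one <;> first | linarith | omega
      _ ≤ (Real.exp (-δ)) ^ K := by
          refine pow_le_pow_left₀ (by linarith) ?_ _
          have := Real.add_one_le_exp (-δ)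
          linarith
      _ = Real.exp (-(δ * K)) := by rw [← Real.exp_nat_mul]; ring_nf
      _ ≤ Real.exp (Real.log n * (-(α + 15))) := by
          rw [Real.exp_le_exp]
          have : δ * ((α + 15) / δ * Real.log n) ≤ δ * K := by gcongr
          have h2 : δ * ((α + 15) / δ * Real.log n) = (α + 15) * Real.log n := by field_simp
          linarith
      _ = _ := by rw [Real.rpow_def_of_pos hn0]
  have h2 : (2 * n + 1) ^ 3 * ((n + 1) * 24) ≤ n ^ 15 := by
    calc (2 * n + 1) ^ 3 * ((n + 1) * 24) ≤ (3 * n) ^ 3 * ((2 * n) * 24) := by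
          gcongr <;> omega
      _ = 1296 * n ^ 4 := by ring
      _ ≤ 2 ^ 11 * n ^ 4 := by gcongr; norm_num
      _ ≤ n ^ 11 * n ^ 4 := by gcongr
      _ = n ^ 15 := by ring
  have h2' : (((2 * n + 1) ^ 3 * ((n + 1) * 24) : ℕ) : ℝ) ≤ (n : ℝ) ^ (15 : ℝ) := by
    have : (((2 * n + 1) ^ 3 * ((n + 1) * 24) : ℕ) : ℝ) ≤ ((n ^ 15 : ℕ) : ℝ) := by
      exact_mod_cast h2
    refine this.trans ?_
    rw [show (15 : ℝ) = ((15 : ℕ) : ℝ) by norm_num, Real.rpow_natCast]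
    push_cast
    exact le_rfl
  calc _ ≤ (n : ℝ) ^ (15 : ℝ) * (n : ℝ) ^ (-(α + 15)) := by
        apply mul_le_mul h2' h1
        · apply pow_nonneg; linarith
        · positivity
    _ = (n : ℝ) ^ (-α) := by
        rw [← Real.rpow_add hn0]
        congr 1
        ring

lemma cost_bound {C : ℝ} (hC : 0 < C) (n : ℕ) (hn : 2 ≤ n) :
    ((2 * (6 * (⌈C * Real.log n⌉₊ + 1) * (Nat.log 2 n + 1) + 12) : ℕ) : ℝ) ≤
      (48 * (C + 4) + 96) * Real.log n ^ 2 := by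
  have hL : 1 / 2 ≤ Real.log n := by
    have h1 : Real.log 2 ≤ Real.log n := Real.log_le_log (by norm_num) (by exact_mod_cast hn)
    have := Real.log_two_gt_d9
    linarith
  set L := Real.log n with hLdef
  have hK : ((⌈C * L⌉₊ + 1 : ℕ) : ℝ) ≤ (C + 4) * L := by
    have := Nat.ceil_lt_add_one (show 0 ≤ C * L by positivity)
    push_cast
    linarith
  have hT : ((Nat.log 2 n + 1 : ℕ) : ℝ) ≤ 4 * L := by
    have h1 : ((2 ^ Nat.log 2 n : ℕ) : ℝ) ≤ n := by
      exact_mod_cast Nat.pow_log_le_self 2 (by omega)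
    have h2 := Real.log_le_log (by positivity) h1
    push_cast at h2
    rw [Real.log_pow] at h2
    have h3 := Real.log_two_gt_d9
    have h4 : (Nat.log 2 n : ℝ) * (1 / 2) ≤ (Nat.log 2 n : ℝ) * Real.log 2 := by
      gcongr
      linarith
    push_cast
    linarith
  have hKT := mul_le_mul hK hT (by positivity) (by positivity)
  push_cast at hKT ⊢
  nlinarith

/-- If `θ(p) > 0` and `α > 0`, there is a constant `κ > 0` such that for every `n ≥ 2`,
with probability at least `1 - 1/n^α`: (i) every `x ∈ Λ(n) ∖ Λ(n/4)` can be joined to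
some `y ∈ Λ(n/4)` with travel time at most `κ (ln n)²`, and (ii) the travel time between
any two points of `Λ(n/4)` is at most `κ (ln n)²`. -/
theorem stmt_18 (p : ℝ) (hp : p ∈ Set.Icc (0 : ℝ) 1)
    (P : Measure Config) [IsProbabilityMeasure P] (hP : IsBernoulli p P)
    (hθ : 0 < theta P) (α : ℝ) (hα : 0 < α) :
    ∃ κ : ℝ, 0 < κ ∧ ∀ n : ℕ, 2 ≤ n →
      1 - 1 / (n : ℝ≥0∞) ^ α ≤
        P {ω |
          (∀ x ∈ box n \ box ((n : ℝ) / 4), ∃ y ∈ box ((n : ℝ) / 4),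
            travelTime ω (box n) x y ≤ ENNReal.ofReal (κ * Real.log n ^ 2)) ∧
          (∀ x ∈ box ((n : ℝ) / 4), ∀ y ∈ box ((n : ℝ) / 4),
            travelTime ω (box n) x y ≤ ENNReal.ofReal (κ * Real.log n ^ 2))} := by
  set δ : ℝ := (theta P).toReal / 24 with hδdef
  have hθ1 : theta P ≤ 1 := prob_le_one
  have hθt : 0 < (theta P).toReal := ENNReal.toReal_pos hθ.ne' (ne_top_of_le_ne_top (by simp) hθ1)
  have hθt1 : (theta P).toReal ≤ 1 := by simpa using ENNReal.toReal_mono (by simp) hθ1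
  have hδ : 0 < δ := by positivity
  have hδ1 : δ ≤ 1 := by rw [hδdef]; linarith
  set C : ℝ := (α + 15) / δ with hCdef
  have hC : 0 < C := by positivity
  refine ⟨48 * (C + 4) + 96, by positivity, fun n hn => ?_⟩
  set K : ℕ := ⌈C * Real.log n⌉₊ + 1 with hKdef
  set T : ℕ := Nat.log 2 n + 1 with hTdef
  have hT : n ≤ 2 ^ T := (Nat.lt_pow_succ_log_self (by norm_num) n).le
  have hcost : ((2 * (6 * K * T + 12) : ℕ) : ℝ≥0∞) ≤
      ENNReal.ofReal ((48 * (C + 4) + 96) * Real.log n ^ 2) := by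
    rw [← ENNReal.ofReal_natCast]
    exact ENNReal.ofReal_le_ofReal (cost_bound hC n hn)
  have hgood : ∀ ω, GoodCfg n K ω → ∀ x ∈ box n, ∀ y ∈ box n,
      travelTime ω (box n) x y ≤ ENNReal.ofReal ((48 * (C + 4) + 96) * Real.log n ^ 2) := by
    intro ω hω x hx y hy
    rw [← cube_eq_box] at hx hy ⊢
    have h1 := reach_zero (by omega) hω (by omega) hT (x := x) (fun j => by simpa using hx j)
    have h2 := reach_zero (by omega) hω (by omega) hT (x := y) (fun j => by simpa using hy j)
    exact ((h1.trans h2.symm).mono (by omega)).travelTime_le.trans hcost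
  have hbox : box ((n : ℝ) / 4) ⊆ box n := by
    intro z hz i
    have := hz i
    have hn0 : (0 : ℝ) ≤ n := by positivity
    linarith
  have h0 : (0 : Site) ∈ box ((n : ℝ) / 4) := by
    intro i
    simp only [Pi.zero_apply, Int.cast_zero, abs_zero]
    positivity
  have hbad : P {ω | ¬ GoodCfg n K ω} ≤ 1 / (n : ℝ≥0∞) ^ α := by
    refine (prob_bad hp hP n K).trans ?_
    have hn0 : (0 : ℝ) < n := by positivity
    have h1 : 1 / (n : ℝ≥0∞) ^ α = ENNReal.ofReal ((n : ℝ) ^ (-α)) := by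
      rw [← ENNReal.ofReal_rpow_of_pos hn0, ENNReal.ofReal_natCast, ENNReal.rpow_neg, one_div]
    rw [h1, ← ENNReal.ofReal_natCast, ← ENNReal.ofReal_pow (by linarith),
      ← ENNReal.ofReal_mul (by positivity)]
    refine ENNReal.ofReal_le_ofReal (real_bound hδ hδ1 n K hn ?_)
    rw [hKdef]
    push_cast
    have := Nat.le_ceil (C * Real.log n)
    linarith
  set E : Set Config := {ω |
          (∀ x ∈ box n \ box ((n : ℝ) / 4), ∃ y ∈ box ((n : ℝ) / 4),
            travelTime ω (box n) x y ≤
              ENNReal.ofReal ((48 * (C + 4) + 96) * Real.log n ^ 2)) ∧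
          (∀ x ∈ box ((n : ℝ) / 4), ∀ y ∈ box ((n : ℝ) / 4),
            travelTime ω (box n) x y ≤
              ENNReal.ofReal ((48 * (C + 4) + 96) * Real.log n ^ 2))} with hE
  have hEc : Eᶜ ⊆ {ω | ¬ GoodCfg n K ω} := by
    intro ω hω hg
    apply hω
    exact ⟨fun x hx => ⟨0, h0, hgood ω hg x hx.1 0 (hbox h0)⟩,
      fun x hx y hy => hgood ω hg x (hbox hx) y (hbox hy)⟩
  rw [tsub_le_iff_right]
  calc (1 : ℝ≥0∞) = P Set.univ := measure_univ.symm
    _ = P (E ∪ Eᶜ) := by rw [Set.union_compl_self]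
    _ ≤ P E + P Eᶜ := measure_union_le _ _
    _ ≤ P E + 1 / (n : ℝ≥0∞) ^ α := by
        gcongr
        exact (measure_mono hEc).trans hbad
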